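/- If features F_1, ..., F_K are conditionally independent given the class H, then the information gain set function A ↦ I(H; F_A) is submodular: for all A ⊆ B ⊆ {1,...,K} and j ∉ B, I(H; F_{A∪{j}}) − I(H; F_A) ≥ I(H; F_{B∪{j}}) − I(H; F_B). -/

import Mathlib

open Finset

open scoped Classical in
/-- Probability of an event on a finite probability space with weights `p`. -/
noncomputable def pr {Ω : Type*} [Fintype Ω] (p : Ω → ℝ) (E : Ω → Prop) : ℝ :=
  ∑ ω ∈ Finset.univ.filter E, p ω

/-- Shannon entropy (in bits) of a finite-valued random variable `X`. -/
noncomputable def ent {Ω α : Type*} [Fintype Ω] [Fintype α] (p : Ω → ℝ) (X : Ω → α) : ℝ :=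
  -∑ a : α, pr p (fun ω => X ω = a) * Real.logb 2 (pr p (fun ω => X ω = a))

/-- Conditional entropy `H(X | Y) = H(X, Y) - H(Y)`. -/
noncomputable def condEnt {Ω α β : Type*} [Fintype Ω] [Fintype α] [Fintype β]
    (p : Ω → ℝ) (X : Ω → α) (Y : Ω → β) : ℝ :=
  ent p (fun ω => (X ω, Y ω)) - ent p Y

/-- Mutual information `I(X ; Y) = H(X) - H(X | Y)`. -/
noncomputable def mi {Ω α β : Type*} [Fintype Ω] [Fintype α] [Fintype β]
    (p : Ω → ℝ) (X : Ω → α) (Y : Ω → β) : ℝ :=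
  ent p X - condEnt p X Y

/-- The tuple of features indexed by `A`: the restriction of the feature vector to
`A`, recorded as an `Option`-valued function (`none` outside `A`). -/
def FA {Ω V : Type*} {K : ℕ} (F : Fin K → Ω → V) (A : Finset (Fin K)) (ω : Ω) :
    Fin K → Option V :=
  fun i => if i ∈ A then some (F i ω) else none

/-- The features `F_1, …, F_K` are (mutually) conditionally independent given the
class `H`:  for every class value and every finite set of features, the joint
conditional distribution factorizes (stated multiplicatively to avoid division). -/
def CondIndep {Ω Hy V : Type*} [Fintype Ω] (p : Ω → ℝ) (H : Ω → Hy)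
    {K : ℕ} (F : Fin K → Ω → V) : Prop :=
  ∀ (h : Hy) (A : Finset (Fin K)) (g : Fin K → V),
    pr p (fun ω => H ω = h ∧ ∀ i ∈ A, F i ω = g i) * (pr p (fun ω => H ω = h)) ^ A.card
      = pr p (fun ω => H ω = h) * ∏ i ∈ A, pr p (fun ω => H ω = h ∧ F i ω = g i)

open scoped Classical in
lemma pr_eq_ite {Ω : Type*} [Fintype Ω] (p : Ω → ℝ) (E : Ω → Prop) :
    pr p E = ∑ ω, if E ω then p ω else 0 := by
  unfold pr
  rw [Finset.sum_filter]

lemma pr_nonneg {Ω : Type*} [Fintype Ω] (p : Ω → ℝ) (hp : ∀ ω, 0 ≤ p ω) (E : Ω → Prop) :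
    0 ≤ pr p E := Finset.sum_nonneg (fun ω _ => hp ω)

lemma pr_pos {Ω : Type*} [Fintype Ω] (p : Ω → ℝ) (hp : ∀ ω, 0 ≤ p ω) (E : Ω → Prop)
    (ω : Ω) (hω : 0 < p ω) (hE : E ω) : 0 < pr p E := by
  classical
  unfold pr
  refine lt_of_lt_of_le hω ?_
  exact Finset.single_le_sum (f := p) (fun ω _ => hp ω) (by simp [hE])

lemma sum_pr_mul {Ω α : Type*} [Fintype Ω] [Fintype α] (p : Ω → ℝ) (X : Ω → α) (g : α → ℝ) :
    ∑ a, pr p (fun ω => X ω = a) * g a = ∑ ω, p ω * g (X ω) := by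
  classical
  simp only [pr_eq_ite, Finset.sum_mul]
  rw [Finset.sum_comm]
  refine Finset.sum_congr rfl (fun ω _ => ?_)
  simp [ite_mul]

lemma ent_eq {Ω α : Type*} [Fintype Ω] [Fintype α] (p : Ω → ℝ) (X : Ω → α) :
    ent p X = -∑ ω, p ω * Real.logb 2 (pr p (fun ω' => X ω' = X ω)) := by
  unfold ent
  rw [sum_pr_mul p X (fun a => Real.logb 2 (pr p (fun ω' => X ω' = a)))]

lemma sum_pr_and {Ω γ : Type*} [Fintype Ω] [Fintype γ] (p : Ω → ℝ) (E : Ω → Prop) (Z : Ω → γ) :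
    ∑ z, pr p (fun ω => E ω ∧ Z ω = z) = pr p E := by
  classical
  simp only [pr_eq_ite]
  rw [Finset.sum_comm]
  refine Finset.sum_congr rfl (fun ω _ => ?_)
  by_cases h : E ω <;> simp [h]

/-- The key sum estimate behind strong subadditivity. -/
lemma ratio_sum_le {Ω α β γ : Type*} [Fintype Ω] [Fintype α] [Fintype γ]
    (p : Ω → ℝ) (hp : ∀ ω, 0 ≤ p ω) (hsum : ∑ ω, p ω = 1)
    (X : Ω → α) (f : α → β) (Z : Ω → γ) :
    ∑ ω, p ω * (pr p (fun ω' => X ω' = X ω) * pr p (fun ω' => f (X ω') = f (X ω) ∧ Z ω' = Z ω)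
      / (pr p (fun ω' => X ω' = X ω ∧ Z ω' = Z ω) * pr p (fun ω' => f (X ω') = f (X ω)))) ≤ 1 := by
  classical
  have h1 := sum_pr_mul p (fun ω => (X ω, Z ω)) (fun c =>
    pr p (fun ω' => X ω' = c.1) * pr p (fun ω' => f (X ω') = f c.1 ∧ Z ω' = c.2)
      / (pr p (fun ω' => X ω' = c.1 ∧ Z ω' = c.2) * pr p (fun ω' => f (X ω') = f c.1)))
  simp only at h1
  rw [← h1, Fintype.sum_prod_type]
  have h2 : ∑ x, pr p (fun ω => X ω = x) = 1 := by
    have := sum_pr_mul p X (fun _ => 1)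
    simpa [hsum] using this
  rw [← h2]
  refine Finset.sum_le_sum (fun x _ => ?_)
  have hx := pr_nonneg p hp (fun ω => X ω = x)
  have hy := pr_nonneg p hp (fun ω => f (X ω) = f x)
  calc _ ≤ ∑ z, pr p (fun ω => X ω = x) / pr p (fun ω => f (X ω) = f x)
          * pr p (fun ω => f (X ω) = f x ∧ Z ω = z) := by
        refine Finset.sum_le_sum (fun z _ => ?_)
        simp only [Prod.mk.injEq]
        have hz := pr_nonneg p hp (fun ω => f (X ω) = f x ∧ Z ω = z)
        rcases eq_or_ne (pr p (fun ω => X ω = x ∧ Z ω = z)) 0 with h0 | h0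
        · rw [h0, zero_mul]; positivity
        · apply le_of_eq
          rw [← div_div, mul_div_assoc', mul_div_assoc', mul_div_cancel_left₀ _ h0]
          ring
    _ = pr p (fun ω => X ω = x) / pr p (fun ω => f (X ω) = f x) * pr p (fun ω => f (X ω) = f x) := by
        rw [← Finset.mul_sum, sum_pr_and]
    _ ≤ _ := by
        rcases eq_or_ne (pr p (fun ω => f (X ω) = f x)) 0 with h0 | h0
        · rw [h0, mul_zero]; exact hx
        · rw [div_mul_cancel₀ _ h0]

lemma ssa {Ω α β γ : Type*} [Fintype Ω] [Fintype α] [Fintype γ]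
    (p : Ω → ℝ) (hp : ∀ ω, 0 ≤ p ω) (hsum : ∑ ω, p ω = 1)
    (X : Ω → α) (f : α → β) (Z : Ω → γ) :
    ∑ ω, p ω * (Real.logb 2 (pr p (fun ω' => X ω' = X ω))
      + Real.logb 2 (pr p (fun ω' => f (X ω') = f (X ω) ∧ Z ω' = Z ω))
      - Real.logb 2 (pr p (fun ω' => X ω' = X ω ∧ Z ω' = Z ω))
      - Real.logb 2 (pr p (fun ω' => f (X ω') = f (X ω)))) ≤ 0 := by
  have key := ratio_sum_le p hp hsum X f Z
  have hl : 0 < Real.log 2 := Real.log_pos (by norm_num)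
  calc _ ≤ ∑ ω, (p ω * (pr p (fun ω' => X ω' = X ω)
            * pr p (fun ω' => f (X ω') = f (X ω) ∧ Z ω' = Z ω)
      / (pr p (fun ω' => X ω' = X ω ∧ Z ω' = Z ω) * pr p (fun ω' => f (X ω') = f (X ω)))) - p ω)
          / Real.log 2 := by
        refine Finset.sum_le_sum (fun ω _ => ?_)
        rcases (hp ω).eq_or_lt with h0 | h0
        · simp [← h0]
        have a1 := pr_pos p hp (fun ω' => X ω' = X ω) ω h0 rfl
        have a2 := pr_pos p hp (fun ω' => f (X ω') = f (X ω) ∧ Z ω' = Z ω) ω h0 ⟨rfl, rfl⟩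
        have a3 := pr_pos p hp (fun ω' => X ω' = X ω ∧ Z ω' = Z ω) ω h0 ⟨rfl, rfl⟩
        have a4 := pr_pos p hp (fun ω' => f (X ω') = f (X ω)) ω h0 rfl
        generalize pr p (fun ω' => X ω' = X ω) = x1 at *
        generalize pr p (fun ω' => f (X ω') = f (X ω) ∧ Z ω' = Z ω) = x2 at *
        generalize pr p (fun ω' => X ω' = X ω ∧ Z ω' = Z ω) = x3 at *
        generalize pr p (fun ω' => f (X ω') = f (X ω)) = x4 at *
        have h := Real.log_le_sub_one_of_pos (x := x1 * x2 / (x3 * x4)) (by positivity)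
        rw [Real.log_div (by positivity) (by positivity), Real.log_mul a1.ne' a2.ne',
          Real.log_mul a3.ne' a4.ne'] at h
        have h' := mul_le_mul_of_nonneg_left h h0.le
        rw [le_div_iff₀ hl]
        unfold Real.logb
        have e : p ω * (Real.log x1 / Real.log 2 + Real.log x2 / Real.log 2
            - Real.log x3 / Real.log 2 - Real.log x4 / Real.log 2) * Real.log 2
            = p ω * (Real.log x1 + Real.log x2 - (Real.log x3 + Real.log x4)) := by
          field_simp
          ring
        rw [e]
        linarith
    _ ≤ 0 := by
        rw [← Finset.sum_div, Finset.sum_sub_distrib, hsum]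
        exact div_nonpos_of_nonpos_of_nonneg (by linarith) hl.le

lemma FA_eq_iff {Ω V : Type*} {K : ℕ} (F : Fin K → Ω → V) (A : Finset (Fin K)) (ω ω' : Ω) :
    FA F A ω' = FA F A ω ↔ ∀ i ∈ A, F i ω' = F i ω := by
  constructor
  · intro h i hi
    have := congrFun h i
    simpa [FA, hi] using this
  · intro h
    funext i
    by_cases hi : i ∈ A
    · simp [FA, hi, h i hi]
    · simp [FA, hi]

/-- Pointwise log form of conditional independence. -/
lemma ci_log {Ω Hy V : Type*} [Fintype Ω] {K : ℕ} (p : Ω → ℝ) (hp : ∀ ω, 0 ≤ p ω)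
    (H : Ω → Hy) (F : Fin K → Ω → V) (hci : CondIndep p H F) (A : Finset (Fin K)) (j : Fin K)
    (hj : j ∉ A) (ω : Ω) (hω : 0 < p ω) :
    Real.logb 2 (pr p (fun ω' => (H ω', FA F (insert j A) ω') = (H ω, FA F (insert j A) ω)))
      - Real.logb 2 (pr p (fun ω' => (H ω', FA F A ω') = (H ω, FA F A ω)))
      = Real.logb 2 (pr p (fun ω' => H ω' = H ω ∧ F j ω' = F j ω))
        - Real.logb 2 (pr p (fun ω' => H ω' = H ω)) := by
  simp only [Prod.mk.injEq, FA_eq_iff]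
  have e1 := hci (H ω) (insert j A) (fun i => F i ω)
  have e2 := hci (H ω) A (fun i => F i ω)
  rw [Finset.card_insert_of_notMem hj, Finset.prod_insert hj] at e1
  have a1 := pr_pos p hp (fun ω' => H ω' = H ω ∧ ∀ i ∈ insert j A, F i ω' = F i ω) ω hω
    ⟨rfl, fun _ _ => rfl⟩
  have a2 := pr_pos p hp (fun ω' => H ω' = H ω ∧ ∀ i ∈ A, F i ω' = F i ω) ω hω
    ⟨rfl, fun _ _ => rfl⟩
  have a3 := pr_pos p hp (fun ω' => H ω' = H ω ∧ F j ω' = F j ω) ω hω ⟨rfl, rfl⟩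
  have a4 := pr_pos p hp (fun ω' => H ω' = H ω) ω hω rfl
  generalize pr p (fun ω' => H ω' = H ω ∧ ∀ i ∈ insert j A, F i ω' = F i ω) = x1 at *
  generalize pr p (fun ω' => H ω' = H ω ∧ ∀ i ∈ A, F i ω' = F i ω) = x2 at *
  generalize pr p (fun ω' => H ω' = H ω ∧ F j ω' = F j ω) = x3 at *
  generalize pr p (fun ω' => H ω' = H ω) = x4 at *
  have e3 : x1 * x4 = x3 * x2 := by
    have hpow : x4 ^ A.card ≠ 0 := (pow_pos a4 _).ne'
    apply mul_right_cancel₀ hpow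
    calc x1 * x4 * x4 ^ A.card = x1 * x4 ^ (A.card + 1) := by ring
      _ = x3 * (x2 * x4 ^ A.card) := by rw [e1, e2]; ring
      _ = _ := by ring
  have e4 := congrArg (Real.logb 2) e3
  rw [Real.logb_mul a1.ne' a4.ne', Real.logb_mul a3.ne' a2.ne'] at e4
  linarith

/-- If the features are conditionally independent given the class `H`, then the
information-gain set function `A ↦ I(H ; F_A)` is submodular: for `A ⊆ B` and
`j ∉ B`, the marginal gain of adding feature `j` to `B` is at most the marginal gain
of adding it to `A`. -/
theorem info_gain_submodular {Ω Hy V : Type*} [Fintype Ω] [Fintype Hy] [Fintype V]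
    {K : ℕ} (p : Ω → ℝ) (hp : ∀ ω, 0 ≤ p ω) (hsum : ∑ ω, p ω = 1)
    (H : Ω → Hy) (F : Fin K → Ω → V) (hci : CondIndep p H F)
    (A B : Finset (Fin K)) (hAB : A ⊆ B) (j : Fin K) (hj : j ∉ B) :
    mi p H (FA F (insert j B)) - mi p H (FA F B)
      ≤ mi p H (FA F (insert j A)) - mi p H (FA F A) := by
  have key := ssa p hp hsum (FA F B) (fun x i => if i ∈ A then x i else none) (F j)
  have hf : ∀ ω, (fun i => if i ∈ A then FA F B ω i else none) = FA F A ω := by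
    intro ω
    funext i
    by_cases hi : i ∈ A
    · simp [FA, hi, hAB hi]
    · simp [FA, hi]
  simp only [hf] at key
  have hins : ∀ (C : Finset (Fin K)) (ω ω' : Ω), (FA F C ω' = FA F C ω ∧ F j ω' = F j ω)
      ↔ FA F (insert j C) ω' = FA F (insert j C) ω := by
    intro C ω ω'
    simp only [FA_eq_iff, Finset.forall_mem_insert]
    exact and_comm
  simp only [hins] at key
  have hz : ∑ ω, p ω * (
      (Real.logb 2 (pr p (fun ω' => (H ω', FA F (insert j B) ω') = (H ω, FA F (insert j B) ω)))
      - Real.logb 2 (pr p (fun ω' => (H ω', FA F B ω') = (H ω, FA F B ω))))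
      - (Real.logb 2 (pr p (fun ω' => (H ω', FA F (insert j A) ω') = (H ω, FA F (insert j A) ω)))
      - Real.logb 2 (pr p (fun ω' => (H ω', FA F A ω') = (H ω, FA F A ω))))) = 0 := by
    refine Finset.sum_eq_zero (fun ω _ => ?_)
    rcases (hp ω).eq_or_lt with h0 | h0
    · simp [← h0]
    rw [ci_log p hp H F hci B j hj ω h0, ci_log p hp H F hci A j (fun h => hj (hAB h)) ω h0]
    simp
  simp only [mul_sub, mul_add, Finset.sum_sub_distrib, Finset.sum_add_distrib] at key hz
  unfold mi condEnt
  simp only [ent_eq]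
  linarith
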